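/- For every natural number k and every robust maximal independent set M of the graph G_k: if α_0 ∈ M, then for every i with 0 ≤ i ≤ k one has b_i ∈ M, a_i ∉ M and c_i ∉ M. -/

import Mathlib

/-- A set of vertices is independent in `G` if no two of its members are adjacent. -/
def IsIndep {V : Type*} (G : SimpleGraph V) (M : Set V) : Prop :=
  ∀ ⦃u⦄, u ∈ M → ∀ ⦃v⦄, v ∈ M → ¬ G.Adj u v

/-- A maximal independent set of `G`: independent and maximal w.r.t. inclusion among
independent sets of `G`. -/
def IsMIS {V : Type*} (G : SimpleGraph V) (M : Set V) : Prop :=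
  IsIndep G M ∧ ∀ S : Set V, IsIndep G S → M ⊆ S → S = M

/-- A robust MIS of `G`: an MIS of `G` that remains a maximal independent set in every
connected spanning subgraph of `G` (a spanning subgraph being a graph on the same vertex
set whose edge set is contained in that of `G`). -/
def IsRobustMIS {V : Type*} (G : SimpleGraph V) (M : Set V) : Prop :=
  IsMIS G M ∧ ∀ H : SimpleGraph V, H ≤ G → H.Connected → IsMIS H M

/-- Vertices of the graph `G_k`: six families `a_i, b_i, c_i, α_i, β_i, γ_i` for `0 ≤ i ≤ k`. -/
inductive GV (k : ℕ) : Type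
  | a : Fin (k + 1) → GV k
  | b : Fin (k + 1) → GV k
  | c : Fin (k + 1) → GV k
  | al : Fin (k + 1) → GV k  -- α
  | be : Fin (k + 1) → GV k  -- β
  | ga : Fin (k + 1) → GV k  -- γ
  deriving DecidableEq

/-- Base relation generating the edges of `G_k`: the 6-cycle
`a₀–b₀–c₀–γ₀–β₀–α₀–a₀` of `G₀`, and for each `1 ≤ i ≤ k` the edges
`{β_{i-1},α_i}, {β_{i-1},γ_i}, {α_i,β_i}, {γ_i,β_i}, {b_{i-1},a_i}, {b_{i-1},c_i},
{a_i,b_i}, {c_i,b_i}`. -/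
def gkRel (k : ℕ) : GV k → GV k → Prop
  | GV.a i, GV.b j => i = j ∨ (i : ℕ) = (j : ℕ) + 1      -- a_i–b_i and b_{i-1}–a_i
  | GV.b i, GV.c j => i = j ∨ (j : ℕ) = (i : ℕ) + 1      -- b_i–c_i and b_{i-1}–c_i
  | GV.al i, GV.be j => i = j ∨ (i : ℕ) = (j : ℕ) + 1    -- α_i–β_i and β_{i-1}–α_i
  | GV.be i, GV.ga j => i = j ∨ (j : ℕ) = (i : ℕ) + 1    -- β_i–γ_i and β_{i-1}–γ_i
  | GV.c i, GV.ga j => i = 0 ∧ j = 0                     -- c₀–γ₀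
  | GV.al i, GV.a j => i = 0 ∧ j = 0                     -- α₀–a₀
  | _, _ => False

/-- The graph `G_k`. -/
def Gk (k : ℕ) : SimpleGraph (GV k) := SimpleGraph.fromRel (gkRel k)

/-- The set `M1 = {α_i, γ_i, b_i : 0 ≤ i ≤ k}`. -/
def M1 (k : ℕ) : Set (GV k) :=
  {v | ∃ i : Fin (k + 1), v = GV.al i ∨ v = GV.ga i ∨ v = GV.b i}

/-- The set `M2 = {a_i, c_i, β_i : 0 ≤ i ≤ k}`. -/
def M2 (k : ℕ) : Set (GV k) :=
  {v | ∃ i : Fin (k + 1), v = GV.a i ∨ v = GV.c i ∨ v = GV.be i}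

theorem IsMIS.exists_adj {V : Type*} {G : SimpleGraph V} {M : Set V} (hM : IsMIS G M)
    {v : V} (hv : v ∉ M) : ∃ w ∈ M, G.Adj v w := by
  by_contra! hn
  refine hv ?_
  rw [← hM.2 (insert v M) ?_ (Set.subset_insert v M)]
  · exact Set.mem_insert v M
  · rintro x (rfl | hx) y (rfl | hy)
    · exact G.irrefl
    · exact hn y hy
    · exact fun hxy => hn x hx hxy.symm
    · exact hM.1 hx hy

/-- If the edge `uv` lies on a cycle, a vertex `v` outside a robust MIS has a neighbour in it
other than `u`. -/
theorem IsRobustMIS.exists_adj_ne {V : Type*} {G : SimpleGraph V} {M : Set V}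
    (hM : IsRobustMIS G M) (hG : G.Connected) {u v : V} (hv : v ∉ M)
    (huv : (G.deleteEdges {s(u, v)}).Reachable u v) : ∃ w ∈ M, w ≠ u ∧ G.Adj v w := by
  have hconn : (G.deleteEdges {s(u, v)}).Connected := by
    refine hG.connected_delete_edge_of_not_isBridge fun hb => ?_
    exact (SimpleGraph.isBridge_iff.1 hb) huv
  obtain ⟨w, hw, hadj⟩ := (hM.2 _ (SimpleGraph.deleteEdges_le _) hconn).exists_adj hv
  rw [SimpleGraph.deleteEdges_adj] at hadj
  refine ⟨w, hw, ?_, hadj.1⟩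
  rintro rfl
  exact hadj.2 Sym2.eq_swap

theorem Gk_connected (k : ℕ) : (Gk k).Connected := by
  have hba (i j : Fin (k + 1)) (h : i = j ∨ (i : ℕ) = j + 1) :
      (Gk k).Reachable (GV.a i) (GV.b j) :=
    SimpleGraph.Adj.reachable (by simp [Gk, gkRel, h])
  have hbc (i j : Fin (k + 1)) (h : i = j ∨ (j : ℕ) = i + 1) :
      (Gk k).Reachable (GV.b i) (GV.c j) :=
    SimpleGraph.Adj.reachable (by simp [Gk, gkRel, h])
  have hab (i j : Fin (k + 1)) (h : i = j ∨ (i : ℕ) = j + 1) :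
      (Gk k).Reachable (GV.al i) (GV.be j) :=
    SimpleGraph.Adj.reachable (by simp [Gk, gkRel, h])
  have hbg (i j : Fin (k + 1)) (h : i = j ∨ (j : ℕ) = i + 1) :
      (Gk k).Reachable (GV.be i) (GV.ga j) :=
    SimpleGraph.Adj.reachable (by simp [Gk, gkRel, h])
  have h0 : (Gk k).Reachable (GV.al 0) (GV.a 0) :=
    SimpleGraph.Adj.reachable (by simp [Gk, gkRel])
  have hb (i : Fin (k + 1)) : (Gk k).Reachable (GV.b 0) (GV.b i) := by
    induction i using Fin.induction with
    | zero => rfl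
    | succ i ih =>
      exact ih.trans ((hba _ _ (.inr (by simp))).symm.trans (hba i.succ _ (.inl rfl)))
  have hbe (i : Fin (k + 1)) : (Gk k).Reachable (GV.b 0) (GV.be i) := by
    induction i using Fin.induction with
    | zero => exact (hba 0 0 (.inl rfl)).symm.trans (h0.symm.trans (hab 0 0 (.inl rfl)))
    | succ i ih =>
      exact ih.trans ((hab _ _ (.inr (by simp))).symm.trans (hab i.succ _ (.inl rfl)))
  rw [SimpleGraph.connected_iff_exists_forall_reachable]
  refine ⟨GV.b 0, ?_⟩
  rintro (i | i | i | i | i | i)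
  · exact (hb i).trans (hba i i (.inl rfl)).symm
  · exact hb i
  · exact (hb i).trans (hbc i i (.inl rfl))
  · exact (hbe i).trans (hab i i (.inl rfl)).symm
  · exact hbe i
  · exact (hbe i).trans (hbg i i (.inl rfl))

theorem Gk_reachable_deleteEdges_al_a (k : ℕ) :
    ((Gk k).deleteEdges {s(GV.al 0, GV.a 0)}).Reachable (GV.al 0) (GV.a 0) := by
  have h₁ : ((Gk k).deleteEdges {s(GV.al 0, GV.a 0)}).Adj (GV.al 0) (GV.be 0) := by
    simp [Gk, gkRel]
  have h₂ : ((Gk k).deleteEdges {s(GV.al 0, GV.a 0)}).Adj (GV.be 0) (GV.ga 0) := by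
    simp [Gk, gkRel]
  have h₃ : ((Gk k).deleteEdges {s(GV.al 0, GV.a 0)}).Adj (GV.ga 0) (GV.c 0) := by
    simp [Gk, gkRel]
  have h₄ : ((Gk k).deleteEdges {s(GV.al 0, GV.a 0)}).Adj (GV.c 0) (GV.b 0) := by
    simp [Gk, gkRel]
  have h₅ : ((Gk k).deleteEdges {s(GV.al 0, GV.a 0)}).Adj (GV.b 0) (GV.a 0) := by
    simp [Gk, gkRel]
  exact h₁.reachable.trans <| h₂.reachable.trans <| h₃.reachable.trans <|
    h₄.reachable.trans h₅.reachable

theorem Gk_reachable_deleteEdges_b_a (k : ℕ) (i : Fin k) :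
    ((Gk k).deleteEdges {s(GV.b i.castSucc, GV.a i.succ)}).Reachable
      (GV.b i.castSucc) (GV.a i.succ) := by
  have hne : i.succ ≠ i.castSucc := (Fin.castSucc_lt_succ (i := i)).ne'
  have h₁ : ((Gk k).deleteEdges {s(GV.b i.castSucc, GV.a i.succ)}).Adj
      (GV.b i.castSucc) (GV.c i.succ) := by
    simp [Gk, gkRel]
  have h₂ : ((Gk k).deleteEdges {s(GV.b i.castSucc, GV.a i.succ)}).Adj
      (GV.c i.succ) (GV.b i.succ) := by
    simp [Gk, gkRel]
  have h₃ : ((Gk k).deleteEdges {s(GV.b i.castSucc, GV.a i.succ)}).Adj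
      (GV.b i.succ) (GV.a i.succ) := by
    simp [Gk, gkRel, hne]
  exact h₁.reachable.trans <| h₂.reachable.trans h₃.reachable

/-- For every robust MIS `M` of `G_k`: if `α₀ ∈ M`, then for every
`0 ≤ i ≤ k`, `b_i ∈ M`, `a_i ∉ M` and `c_i ∉ M`. -/
theorem stmt_14 (k : ℕ) (M : Set (GV k)) (hM : IsRobustMIS (Gk k) M)
    (h : GV.al (0 : Fin (k + 1)) ∈ M) :
    ∀ i : Fin (k + 1), GV.b i ∈ M ∧ GV.a i ∉ M ∧ GV.c i ∉ M := by
  have hb (i : Fin (k + 1)) : GV.b i ∈ M := by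
    induction i using Fin.induction with
    | zero =>
      have ha : GV.a 0 ∉ M := fun ha => hM.1.1 h ha (by simp [Gk, gkRel])
      obtain ⟨w, hw, hne, hadj⟩ :=
        hM.exists_adj_ne (Gk_connected k) ha (Gk_reachable_deleteEdges_al_a k)
      cases w <;> simp [Gk, gkRel] at hadj hne
      · rwa [hadj]
      · exact absurd hadj hne
    | succ i ih =>
      have ha : GV.a i.succ ∉ M := fun ha => hM.1.1 ih ha (by simp [Gk, gkRel])
      obtain ⟨w, hw, hne, hadj⟩ :=
        hM.exists_adj_ne (Gk_connected k) ha (Gk_reachable_deleteEdges_b_a k i)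
      cases w <;> simp [Gk, gkRel] at hadj hne
      rcases hadj with hadj | hadj
      · rwa [hadj]
      · exact absurd (Fin.ext hadj.symm) hne
  exact fun i => ⟨hb i, fun ha => hM.1.1 (hb i) ha (by simp [Gk, gkRel]),
    fun hc => hM.1.1 (hb i) hc (by simp [Gk, gkRel])⟩
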